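/- Let X be a real-valued random variable with the logistic distribution function F_r(x) = 1/(1 + e^{−πx}). Then for every real t ≠ 0, E(e^{itX}) = t/sinh(t). -/

import Mathlib

open MeasureTheory Real

/-- The quantile function of the logistic distribution with distribution function
`x ↦ 1 / (1 + exp (-π * x))`. -/
noncomputable def logisticQuantile (u : ℝ) : ℝ := Real.log (u / (1 - u)) / π

lemma measurable_logisticQuantile : Measurable logisticQuantile := by
  unfold logisticQuantile
  fun_prop

lemma logisticQuantile_le_iff {u : ℝ} (hu : u ∈ Set.Ioo (0 : ℝ) 1) (x : ℝ) :
    logisticQuantile u ≤ x ↔ u ≤ 1 / (1 + Real.exp (-π * x)) := by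
  have h0 := hu.1
  have h1 : 0 < 1 - u := sub_pos.2 hu.2
  have hmul : Real.exp (x * π) * Real.exp (-π * x) = 1 := by
    rw [← Real.exp_add]
    ring_nf
    exact Real.exp_zero
  have hE := Real.exp_pos (-π * x)
  rw [logisticQuantile, div_le_iff₀ pi_pos, Real.log_le_iff_le_exp (div_pos h0 h1),
    div_le_iff₀ h1, le_div_iff₀ (by positivity), ← mul_le_mul_iff_left₀ hE]
  constructor <;> intro h
  · linear_combination h + (1 - u) * hmul
  · linear_combination h - (1 - u) * hmul

lemma map_logisticQuantile_Iic (x : ℝ) :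
    (volume.restrict (Set.Ioo (0 : ℝ) 1)).map logisticQuantile (Set.Iic x) =
      ENNReal.ofReal (1 / (1 + Real.exp (-π * x))) := by
  have hE := Real.exp_pos (-π * x)
  have hlt : 1 / (1 + Real.exp (-π * x)) < 1 := by
    rw [div_lt_one (by positivity)]
    linarith
  have hset : logisticQuantile ⁻¹' Set.Iic x ∩ Set.Ioo (0 : ℝ) 1 =
      Set.Ioc 0 (1 / (1 + Real.exp (-π * x))) := by
    ext u
    constructor
    · rintro ⟨h, hu⟩
      exact ⟨hu.1, (logisticQuantile_le_iff hu x).1 h⟩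
    · rintro ⟨h0, h⟩
      have hu : u ∈ Set.Ioo (0 : ℝ) 1 := ⟨h0, h.trans_lt hlt⟩
      exact ⟨(logisticQuantile_le_iff hu x).2 h, hu⟩
  rw [Measure.map_apply measurable_logisticQuantile measurableSet_Iic,
    Measure.restrict_apply (measurable_logisticQuantile measurableSet_Iic), hset,
    Real.volume_Ioc, sub_zero]

lemma exp_mul_logisticQuantile {u : ℝ} (hu : u ∈ Set.Ioo (0 : ℝ) 1) (z : ℂ) :
    Complex.exp (z * logisticQuantile u) =
      (u : ℂ) ^ (z / π) * (1 - (u : ℂ)) ^ (-(z / π)) := by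
  have h0 := hu.1
  have h1 : 0 < 1 - u := sub_pos.2 hu.2
  have hcast : (1 - (u : ℂ)) = ((1 - u : ℝ) : ℂ) := by push_cast; rfl
  rw [hcast, Complex.cpow_def_of_ne_zero (by exact_mod_cast h0.ne'),
    Complex.cpow_def_of_ne_zero (by exact_mod_cast h1.ne'), ← Complex.exp_add,
    ← Complex.ofReal_log h0.le, ← Complex.ofReal_log h1.le, logisticQuantile,
    Real.log_div h0.ne' h1.ne']
  push_cast
  ring_nf

lemma betaIntegral_one_add_one_sub {w : ℂ} (hw : w ≠ 0) (hre : w.re = 0) :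
    Complex.betaIntegral (1 + w) (1 - w) = π * w / Complex.sin (π * w) := by
  have h := Complex.Gamma_mul_Gamma_eq_betaIntegral (s := 1 + w) (t := 1 - w)
    (by simp [hre]) (by simp [hre])
  have h2 : Complex.Gamma (1 + w + (1 - w)) = 1 := by
    rw [show 1 + w + (1 - w) = ((1 : ℕ) : ℂ) + 1 by push_cast; ring,
      Complex.Gamma_nat_eq_factorial]
    simp
  rw [h2, one_mul, add_comm 1 w, Complex.Gamma_add_one w hw, mul_assoc,
    Complex.Gamma_mul_Gamma_one_sub] at h
  rw [add_comm 1 w, ← h]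
  ring

theorem logistic_charFun
    {Ω : Type*} [MeasurableSpace Ω] (μ : Measure Ω) [IsProbabilityMeasure μ]
    (X : Ω → ℝ) (hX : Measurable X)
    (hcdf : ∀ x : ℝ, μ {ω | X ω ≤ x} = ENNReal.ofReal (1 / (1 + Real.exp (-π * x))))
    (t : ℝ) (ht : t ≠ 0) :
    ∫ ω, Complex.exp (Complex.I * t * X ω) ∂μ = ((t / Real.sinh t : ℝ) : ℂ) := by
  have hπ : (π : ℂ) ≠ 0 := by exact_mod_cast pi_ne_zero
  have hlaw : μ.map X = (volume.restrict (Set.Ioo (0 : ℝ) 1)).map logisticQuantile := by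
    have := Measure.isProbabilityMeasure_map (μ := μ) hX.aemeasurable
    refine Measure.ext_of_Iic _ _ fun x => ?_
    rw [map_logisticQuantile_Iic, Measure.map_apply hX measurableSet_Iic]
    exact hcdf x
  have hcont : Continuous fun x : ℝ => Complex.exp (Complex.I * t * x) := by fun_prop
  have hw : Complex.I * t / π ≠ 0 := by
    simp [ht]
  have hre : (Complex.I * t / π : ℂ).re = 0 := by
    simp
  calc ∫ ω, Complex.exp (Complex.I * t * X ω) ∂μ
      = ∫ x : ℝ, Complex.exp (Complex.I * t * x) ∂(μ.map X) :=
        (integral_map hX.aemeasurable hcont.aestronglyMeasurable).symm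
    _ = ∫ u in Set.Ioo (0 : ℝ) 1, Complex.exp (Complex.I * t * logisticQuantile u) := by
        rw [hlaw, integral_map measurable_logisticQuantile.aemeasurable
          hcont.aestronglyMeasurable]
    _ = Complex.betaIntegral (1 + Complex.I * t / π) (1 - Complex.I * t / π) := by
        rw [Complex.betaIntegral, intervalIntegral.integral_of_le zero_le_one,
          integral_Ioc_eq_integral_Ioo]
        refine setIntegral_congr_fun measurableSet_Ioo fun u hu => ?_
        simp only [exp_mul_logisticQuantile hu]
        congr 2 <;> ring
    _ = ((t / Real.sinh t : ℝ) : ℂ) := by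
        rw [betaIntegral_one_add_one_sub hw hre, mul_div_cancel₀ _ hπ, mul_comm Complex.I,
          Complex.sin_mul_I, mul_div_mul_right _ _ Complex.I_ne_zero]
        push_cast
        rfl
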